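/- Let p > 2 be a real number. There exists a constant C > 0, depending only on p, such that for all real numbers a, b > 0 one has |a^p - b^p - p·a^{p-1}·(a - b) + (p(p-1)/2)·b^{p-2}·(a - b)^2| ≤ C·a^{max(p-3, 0)}·|a - b|^{min(p, 3)} + C·|a - b|^p. -/

import Mathlib

/-- Second-order Taylor formula with Lagrange remainder for real powers, for either order of the
two points. -/
theorem exists_rpow_sub_eq_lagrange_remainder (p : ℝ) {a b : ℝ} (ha : 0 < a) (hb : 0 < b)
    (hab : a ≠ b) :
    ∃ ξ ∈ Set.uIoo a b, a ^ p - b ^ p - p * a ^ (p - 1) * (a - b) =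
      -(p * (p - 1) / 2 * ξ ^ (p - 2) * (a - b) ^ 2) := by
  let f : ℝ → ℝ := fun t => b ^ p - t ^ p - p * t ^ (p - 1) * (b - t)
  let f' : ℝ → ℝ := fun t => -(p * (p - 1) * t ^ (p - 2) * (b - t))
  let g : ℝ → ℝ := fun t => (b - t) ^ 2
  let g' : ℝ → ℝ := fun t => -(2 * (b - t))
  have hf (t : ℝ) (ht : 0 < t) : HasDerivAt f (f' t) t := by
    have h1 := Real.hasDerivAt_rpow_const (p := p) (Or.inl ht.ne')
    have h2 := Real.hasDerivAt_rpow_const (p := p - 1) (Or.inl ht.ne')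
    have h3 := (h1.const_sub (b ^ p)).sub
      ((h2.const_mul p).mul ((hasDerivAt_id t).const_sub b))
    refine h3.congr_deriv ?_
    rw [show p - 1 - 1 = p - 2 by ring]
    simp only [f', id]
    ring
  have hg (t : ℝ) : HasDerivAt g (g' t) t :=
    (((hasDerivAt_id t).const_sub b).pow 2).congr_deriv (by simp [g'])
  have hpos : ∀ t ∈ Set.uIcc a b, 0 < t := fun t ht => (lt_min ha hb).trans_le ht.1
  have hfc : ContinuousOn f (Set.uIcc a b) := fun t ht =>
    (hf t (hpos t ht)).continuousAt.continuousWithinAt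
  have hgc : ContinuousOn g (Set.uIcc a b) := fun t _ => (hg t).continuousAt.continuousWithinAt
  obtain ⟨ξ, hξ, h⟩ := exists_ratio_hasDerivAt_eq_ratio_slope f f'
    (min_lt_max.2 hab) hfc
    (fun t ht => hf t (hpos t (Set.Ioo_subset_Icc_self ht))) g g' hgc (fun t _ => hg t)
  refine ⟨ξ, hξ, ?_⟩
  have hξb : b - ξ ≠ 0 := by
    intro h0
    obtain rfl : b = ξ := by linarith
    rcases lt_or_gt_of_ne hab with hlt | hlt
    · exact (hξ.2.trans_eq (max_eq_right hlt.le)).false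
    · exact ((min_eq_right hlt.le).symm.trans_lt hξ.1).false
  have h' : (g b - g a) * f' ξ = (f b - f a) * g' ξ := by
    rcases lt_or_gt_of_ne hab with hlt | hlt
    · simpa only [min_eq_left hlt.le, max_eq_right hlt.le] using h
    · rw [min_eq_right hlt.le, max_eq_left hlt.le] at h
      linarith
  simp only [f, f', g, g'] at h'
  apply mul_right_cancel₀ hξb
  linear_combination h' / 2

theorem abs_rpow_sub_rpow_le_rpow_abs_sub {q x y : ℝ} (hq : 0 ≤ q) (hq1 : q ≤ 1) (hx : 0 ≤ x)
    (hy : 0 ≤ y) : |x ^ q - y ^ q| ≤ |x - y| ^ q := by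
  wlog hxy : y ≤ x generalizing x y
  · rw [abs_sub_comm, abs_sub_comm x]
    exact this hy hx (le_of_not_ge hxy)
  have h := Real.rpow_add_le_add_rpow hy (sub_nonneg.2 hxy) hq hq1
  rw [add_sub_cancel] at h
  rw [abs_of_nonneg (sub_nonneg.2 (Real.rpow_le_rpow hy hxy hq)),
    abs_of_nonneg (sub_nonneg.2 hxy)]
  linarith

theorem abs_rpow_sub_rpow_le_mul_abs_sub {q x y M : ℝ} (hq : 1 ≤ q) (hx : x ∈ Set.Icc 0 M)
    (hy : y ∈ Set.Icc 0 M) : |x ^ q - y ^ q| ≤ q * M ^ (q - 1) * |x - y| := by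
  refine (convex_Icc (0 : ℝ) M).norm_image_sub_le_of_norm_hasDerivWithin_le
    (f := fun t => t ^ q) (f' := fun t => q * t ^ (q - 1))
    (fun t _ => (Real.hasDerivAt_rpow_const (Or.inr hq)).hasDerivWithinAt) (fun t ht => ?_) hy hx
  have := Real.rpow_nonneg ht.1 (q - 1)
  rw [Real.norm_of_nonneg (by positivity)]
  have := Real.rpow_le_rpow ht.1 ht.2 (sub_nonneg.2 hq)
  gcongr

theorem add_rpow_le_two_rpow_mul {r x y : ℝ} (hr : 0 ≤ r) (hx : 0 ≤ x) (hy : 0 ≤ y) :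
    (x + y) ^ r ≤ 2 ^ r * (x ^ r + y ^ r) := by
  have hx' := Real.rpow_nonneg hx r
  have hy' := Real.rpow_nonneg hy r
  rcases le_total x y with h | h
  · calc (x + y) ^ r ≤ (2 * y) ^ r := Real.rpow_le_rpow (by positivity) (by linarith) hr
      _ = 2 ^ r * y ^ r := Real.mul_rpow two_pos.le hy
      _ ≤ _ := by gcongr; linarith
  · calc (x + y) ^ r ≤ (2 * x) ^ r := Real.rpow_le_rpow (by positivity) (by linarith) hr
      _ = 2 ^ r * x ^ r := Real.mul_rpow two_pos.le hx
      _ ≤ _ := by gcongr; linarith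

/-- Third-order pointwise Taylor-type inequality for real powers, `p > 2`. -/
theorem pointwise_power_estimate_three (p : ℝ) (hp : 2 < p) :
    ∃ C : ℝ, 0 < C ∧ ∀ a b : ℝ, 0 < a → 0 < b →
      |a ^ p - b ^ p - p * a ^ (p - 1) * (a - b) + p * (p - 1) / 2 * b ^ (p - 2) * (a - b) ^ 2| ≤
        C * a ^ (max (p - 3) 0) * |a - b| ^ (min p 3) + C * |a - b| ^ p := by
  have hK : 0 < p * (p - 1) / 2 := by nlinarith
  set K := p * (p - 1) / 2 with hKdef
  have hp2 : 0 < p - 2 := by linarith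
  suffices ∃ D : ℝ, 0 < D ∧ ∀ a b ξ : ℝ, 0 < a → 0 < b → a ≠ b → ξ ∈ Set.uIoo a b →
      |b ^ (p - 2) - ξ ^ (p - 2)| * |a - b| ^ (2 : ℝ) ≤
        D * (a ^ (max (p - 3) 0) * |a - b| ^ (min p 3) + |a - b| ^ p) by
    obtain ⟨D, hD, h⟩ := this
    refine ⟨K * D, by positivity, fun a b ha hb => ?_⟩
    rcases eq_or_ne a b with rfl | hab
    · simp only [sub_self, mul_zero, ne_eq, OfNat.ofNat_ne_zero, not_false_eq_true, zero_pow,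
        add_zero, abs_zero]
      positivity
    obtain ⟨ξ, hξ, hrem⟩ := exists_rpow_sub_eq_lagrange_remainder p ha hb hab
    have hD' := mul_le_mul_of_nonneg_left (h a b ξ ha hb hab hξ) hK.le
    rw [hrem, ← hKdef]
    calc _ = |K * ((b ^ (p - 2) - ξ ^ (p - 2)) * (a - b) ^ 2)| := by congr 1; ring
      _ = K * (|b ^ (p - 2) - ξ ^ (p - 2)| * |a - b| ^ (2 : ℝ)) := by
        rw [abs_mul, abs_mul, abs_of_pos hK, abs_pow, Real.rpow_two]
      _ ≤ _ := hD'
      _ = _ := by ring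
  have hmem {a b ξ : ℝ} (hξ : ξ ∈ Set.uIoo a b) : |b - ξ| ≤ |a - b| := by
    rw [abs_sub_comm a b]
    exact Set.abs_sub_right_of_mem_uIcc (Set.uIoo_subset_uIcc_self hξ)
  have hpos {a b ξ : ℝ} (ha : 0 < a) (hb : 0 < b) (hξ : ξ ∈ Set.uIoo a b) : 0 < ξ :=
    (lt_min ha hb).trans hξ.1
  rcases le_total p 3 with hp3 | hp3
  · refine ⟨1, one_pos, fun a b ξ ha hb hab hξ => ?_⟩
    have hd : 0 < |a - b| := abs_pos.2 (sub_ne_zero.2 hab)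
    rw [max_eq_right (by linarith), min_eq_left hp3, Real.rpow_zero, one_mul, one_mul]
    calc _ ≤ |a - b| ^ (p - 2) * |a - b| ^ (2 : ℝ) := by
          gcongr
          exact (abs_rpow_sub_rpow_le_rpow_abs_sub hp2.le (by linarith) hb.le
            (hpos ha hb hξ).le).trans
              (Real.rpow_le_rpow (abs_nonneg _) (hmem hξ) hp2.le)
      _ = |a - b| ^ p := by rw [← Real.rpow_add hd]; congr 1; ring
      _ ≤ _ := le_add_of_nonneg_left (by positivity)
  · have hp3' : 0 ≤ p - 3 := by linarith
    refine ⟨(p - 2) * 2 ^ (p - 3), by positivity, fun a b ξ ha hb hab hξ => ?_⟩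
    have hd : 0 < |a - b| := abs_pos.2 (sub_ne_zero.2 hab)
    rw [max_eq_left hp3', min_eq_right hp3]
    have hbM : b ≤ a + |a - b| := by linarith [neg_abs_le (a - b)]
    have hξM : ξ ≤ a + |a - b| :=
      hξ.2.le.trans (max_le (le_add_of_nonneg_right hd.le) hbM)
    calc _ ≤ (p - 2) * (a + |a - b|) ^ (p - 2 - 1) * |b - ξ| * |a - b| ^ (2 : ℝ) := by
          gcongr
          exact abs_rpow_sub_rpow_le_mul_abs_sub (by linarith) ⟨hb.le, hbM⟩
            ⟨(hpos ha hb hξ).le, hξM⟩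
      _ ≤ (p - 2) * (2 ^ (p - 3) * (a ^ (p - 3) + |a - b| ^ (p - 3))) * |a - b| *
            |a - b| ^ (2 : ℝ) := by
          rw [show p - 2 - 1 = p - 3 by ring]
          have := add_rpow_le_two_rpow_mul hp3' ha.le hd.le
          have := hmem hξ
          gcongr
      _ = (p - 2) * 2 ^ (p - 3) * (a ^ (p - 3) * |a - b| ^ (3 : ℝ) +
            |a - b| ^ (p - 3) * |a - b| ^ (3 : ℝ)) := by
          rw [show (3 : ℝ) = 1 + 2 by norm_num, Real.rpow_add hd 1 2, Real.rpow_one]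
          ring
      _ = _ := by rw [← Real.rpow_add hd, sub_add_cancel]
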